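/- Let φ be a flow on a generalized Peano continuum M. Then HS, the set of hyper-stable compact minimal sets, regarded as a subspace of the space of nonempty compact subsets of M with the Hausdorff metric d_H, is locally compact and locally connected. -/

import Mathlib

open Set Filter Topology Metric TopologicalSpace

variable {M : Type*} [MetricSpace M]

/-- A set is invariant under the flow `φ`. -/
def IsFlowInvariant (φ : ℝ → M → M) (K : Set M) : Prop :=
  ∀ x ∈ K, ∀ t : ℝ, φ t x ∈ K

/-- A set is positively invariant under the flow `φ`. -/
def IsPosInvariant (φ : ℝ → M → M) (K : Set M) : Prop :=
  ∀ x ∈ K, ∀ t : ℝ, 0 ≤ t → φ t x ∈ K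

/-- A compact minimal set: nonempty, compact, invariant, with no nonempty proper
closed invariant subset. -/
def IsCompactMinimalSet (φ : ℝ → M → M) (K : Set M) : Prop :=
  K.Nonempty ∧ IsCompact K ∧ IsFlowInvariant φ K ∧
    ∀ K' ⊆ K, K'.Nonempty → IsClosed K' → IsFlowInvariant φ K' → K' = K

/-- Lyapunov stability: every neighborhood of `K` contains a positively invariant
neighborhood of `K`. -/
def IsLyapunovStable (φ : ℝ → M → M) (K : Set M) : Prop :=
  ∀ U ∈ 𝓝ˢ K, ∃ V ∈ 𝓝ˢ K, V ⊆ U ∧ IsPosInvariant φ V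

/-- The ω-limit set of a point. -/
def omegaLimitSet (φ : ℝ → M → M) (x : M) : Set M :=
  ⋂ T ∈ Ici (0 : ℝ), closure ((fun t => φ t x) '' Ici T)

/-- The α-limit set of a point. -/
def alphaLimitSet (φ : ℝ → M → M) (x : M) : Set M :=
  ⋂ T ∈ Iic (0 : ℝ), closure ((fun t => φ t x) '' Iic T)

/-- A compact minimal set is hyper-stable if some neighborhood of it in `M` meets no
Lyapunov unstable compact minimal set. -/
def IsHyperStable (φ : ℝ → M → M) (Λ : Set M) : Prop :=
  IsCompactMinimalSet φ Λ ∧ ∃ W ∈ 𝓝ˢ Λ, ∀ Γ : Set M,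
    IsCompactMinimalSet φ Γ → ¬ IsLyapunovStable φ Γ → Γ ∩ W = ∅

/-- An attractor: a Lyapunov stable nonempty compact invariant set whose basin of
attraction is a neighborhood of it. -/
def IsAttractorSet (φ : ℝ → M → M) (Δ : Set M) : Prop :=
  Δ.Nonempty ∧ IsCompact Δ ∧ IsFlowInvariant φ Δ ∧ IsLyapunovStable φ Δ ∧
    {x : M | (omegaLimitSet φ x).Nonempty ∧ omegaLimitSet φ x ⊆ Δ} ∈ 𝓝ˢ Δ

/-- The flow is non-wandering. -/
def IsNonWanderingFlow (φ : ℝ → M → M) : Prop :=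
  ∀ x : M, ∀ U ∈ 𝓝 x, ∀ T > (0 : ℝ), ∃ t ≥ T, ((fun y => φ t y) '' U ∩ U).Nonempty

/-- The set of hyper-stable compact minimal sets, as a subset of the space of nonempty
compact subsets of `M` (with the Hausdorff metric). -/
def HSset (φ : ℝ → M → M) : Set (NonemptyCompacts M) :=
  {Γ | IsHyperStable φ (Γ : Set M)}

/-- The set of all compact minimal sets, as a subset of the space of nonempty compact
subsets of `M` (with the Hausdorff metric). -/
def CMinSet (φ : ℝ → M → M) : Set (NonemptyCompacts M) :=
  {Γ | IsCompactMinimalSet φ (Γ : Set M)}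

/-- `basinOf φ X` is the set of points whose ω-limit set belongs to `X`. -/
def basinOf (φ : ℝ → M → M) (X : Set (NonemptyCompacts M)) : Set M :=
  {x | ∃ Γ ∈ X, (Γ : Set M) = omegaLimitSet φ x}

/-- The union in `M` of a family of hyper-stable compact minimal sets. -/
def unionSet (φ : ℝ → M → M) (X : Set ↥(HSset φ)) : Set M :=
  {y | ∃ q ∈ X, y ∈ ((q : NonemptyCompacts M) : Set M)}

/-- A nonempty compact invariant set contains a compact minimal set. -/
lemma exists_isCompactMinimalSet_subset {φ : ℝ → M → M} {K : Set M} (hne : K.Nonempty)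
    (hK : IsCompact K) (hinv : IsFlowInvariant φ K) : ∃ Γ ⊆ K, IsCompactMinimalSet φ Γ := by
  obtain ⟨Γ, hΓK, hΓ⟩ := zorn_superset_nonempty
    {L : Set M | L.Nonempty ∧ IsCompact L ∧ IsFlowInvariant φ L} (by
      intro c hc hchain hcne
      have : Nonempty c := hcne.to_subtype
      refine ⟨⋂₀ c, ⟨?_, ?_, ?_⟩, fun s hs => sInter_subset_of_mem hs⟩
      · exact IsCompact.nonempty_sInter_of_directed_nonempty_isCompact_isClosed
          (fun a ha b hb => (hchain.total ha hb).elim (fun h => ⟨a, ha, Subset.rfl, h⟩)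
            fun h => ⟨b, hb, h, Subset.rfl⟩) (fun U hU => (hc hU).1) (fun U hU => (hc hU).2.1)
          (fun U hU => (hc hU).2.1.isClosed)
      · obtain ⟨L, hL⟩ := hcne
        exact (hc hL).2.1.of_isClosed_subset
          (isClosed_sInter fun U hU => (hc hU).2.1.isClosed) (sInter_subset_of_mem hL)
      · exact fun x hx t U hU => (hc hU).2.2 x (hx U hU) t) K ⟨hne, hK, hinv⟩
  refine ⟨Γ, hΓK, hΓ.prop.1, hΓ.prop.2.1, hΓ.prop.2.2, fun L hL hLne hLc hLinv => ?_⟩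
  exact hL.antisymm (hΓ.le_of_le ⟨hLne, hΓ.prop.2.1.of_isClosed_subset hLc hL, hLinv⟩ hL)

/-- Two compact minimal sets that meet are equal. -/
lemma IsCompactMinimalSet.eq_of_inter_nonempty {φ : ℝ → M → M} {Γ Γ' : Set M}
    (hΓ : IsCompactMinimalSet φ Γ) (hΓ' : IsCompactMinimalSet φ Γ') (h : (Γ ∩ Γ').Nonempty) :
    Γ = Γ' := by
  have hclosed : IsClosed (Γ ∩ Γ') := hΓ.2.1.isClosed.inter hΓ'.2.1.isClosed
  have hinv : IsFlowInvariant φ (Γ ∩ Γ') :=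
    fun x hx t => ⟨hΓ.2.2.1 x hx.1 t, hΓ'.2.2.1 x hx.2 t⟩
  exact (hΓ.2.2.2 _ inter_subset_left h hclosed hinv).symm.trans
    (hΓ'.2.2.2 _ inter_subset_right h hclosed hinv)

/-- Every orbit in a compact minimal set visits every open set meeting it. -/
lemma IsCompactMinimalSet.exists_flow_mem {φ : ℝ → M → M}
    (hφcont : Continuous fun p : ℝ × M => φ p.1 p.2) (hφzero : ∀ x : M, φ 0 x = x)
    (hφadd : ∀ s t : ℝ, ∀ x : M, φ s (φ t x) = φ (s + t) x)
    {Γ U : Set M} (hΓ : IsCompactMinimalSet φ Γ) (hU : IsOpen U) (hΓU : (Γ ∩ U).Nonempty)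
    {x : M} (hx : x ∈ Γ) : ∃ t, φ t x ∈ U := by
  by_contra! h
  have hclosed : IsClosed (Γ ∩ {y | ∀ t, φ t y ∉ U}) := by
    refine hΓ.2.1.isClosed.inter ?_
    simp only [ofPred_forall]
    exact isClosed_iInter fun t => hU.isClosed_compl.preimage
      (hφcont.comp (continuous_const.prodMk continuous_id))
  have heq := hΓ.2.2.2 (Γ ∩ {y | ∀ t, φ t y ∉ U}) inter_subset_left ⟨x, hx, h⟩ hclosed
    fun y hy t => ⟨hΓ.2.2.1 y hy.1 t, fun s => by rw [hφadd]; exact hy.2 _⟩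
  obtain ⟨p, hp, hpU⟩ := hΓU
  rw [← heq] at hp
  exact hp.2 0 (by rwa [hφzero])

/-- Compact minimal sets contained in a small neighborhood of a compact minimal set `Γ` are close
to `Γ` in the Hausdorff metric. -/
lemma IsCompactMinimalSet.exists_isOpen_forall_subset_mem {φ : ℝ → M → M}
    (hφcont : Continuous fun p : ℝ × M => φ p.1 p.2) (hφzero : ∀ x : M, φ 0 x = x)
    (hφadd : ∀ s t : ℝ, ∀ x : M, φ s (φ t x) = φ (s + t) x)
    {Γ : NonemptyCompacts M} (hΓ : IsCompactMinimalSet φ (Γ : Set M))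
    {N : Set (NonemptyCompacts M)} (hN : N ∈ 𝓝 Γ) :
    ∃ O : Set M, IsOpen O ∧ (Γ : Set M) ⊆ O ∧ ∀ Γ' : NonemptyCompacts M,
      IsCompactMinimalSet φ (Γ' : Set M) → (Γ' : Set M) ⊆ O → Γ' ∈ N := by
  obtain ⟨_, ⟨u, ⟨hu, -, huo⟩, rfl⟩, hΓu, huN⟩ :=
    NonemptyCompacts.isTopologicalBasis.mem_nhds_iff.1 hN
  refine ⟨⋃₀ u ∩ ⋂ U ∈ u, {x | ∃ t, φ t x ∈ U}, ?_, ?_, ?_⟩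
  · refine (isOpen_sUnion huo).inter (hu.isOpen_biInter fun U hU => ?_)
    simp only [ofPred_exists]
    exact isOpen_iUnion fun t => (huo U hU).preimage
      (hφcont.comp (continuous_const.prodMk continuous_id))
  · exact subset_inter hΓu.1 (subset_iInter₂ fun U hU x hx =>
      hΓ.exists_flow_mem hφcont hφzero hφadd (huo U hU) (hΓu.2 U hU) hx)
  · intro Γ' hΓ' hsub
    refine huN ⟨hsub.trans inter_subset_left, fun U hU => ?_⟩
    obtain ⟨x, hx⟩ := Γ'.nonempty
    obtain ⟨t, ht⟩ := mem_iInter₂.1 (hsub hx).2 U hU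
    exact ⟨φ t x, hΓ'.2.2.1 x hx t, ht⟩

/-- Sets close to `Γ` in the Hausdorff metric are contained in a given neighborhood of `Γ`. -/
lemma TopologicalSpace.NonemptyCompacts.eventually_subset {Γ : NonemptyCompacts M} {O : Set M}
    (hO : O ∈ 𝓝ˢ (Γ : Set M)) : ∀ᶠ Γ' : NonemptyCompacts M in 𝓝 Γ, (Γ' : Set M) ⊆ O := by
  filter_upwards [(NonemptyCompacts.isOpen_subsets_of_isOpen isOpen_interior).mem_nhds
    (subset_interior_iff_mem_nhdsSet.2 hO)] with Γ' hΓ'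
  exact Subset.trans hΓ' interior_subset

lemma isFlowInvariant_setOf_mapClusterPt {φ : ℝ → M → M}
    (hφcont : Continuous fun p : ℝ × M => φ p.1 p.2)
    (hφadd : ∀ s t : ℝ, ∀ x : M, φ s (φ t x) = φ (s + t) x) (x : M) :
    IsFlowInvariant φ {y | MapClusterPt y atTop fun t => φ t x} := by
  intro y hy s
  have h : MapClusterPt (φ s y) atTop (φ s ∘ fun t => φ t x) :=
    MapClusterPt.continuousAt_comp
      (hφcont.comp (continuous_const.prodMk continuous_id)).continuousAt hy
  have heq : (φ s ∘ fun t => φ t x) = (fun t => φ t x) ∘ fun t => s + t :=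
    funext fun t => hφadd s t x
  rw [heq] at h
  exact h.of_comp (tendsto_atTop_add_const_left _ _ tendsto_id)

/-- An orbit clustering at a point of a Lyapunov stable set converges to that set. -/
lemma IsLyapunovStable.tendsto_nhdsSet {φ : ℝ → M → M}
    (hφadd : ∀ s t : ℝ, ∀ x : M, φ s (φ t x) = φ (s + t) x) {Γ : Set M}
    (hΓ : IsLyapunovStable φ Γ) {x y : M} (hy : y ∈ Γ)
    (hxy : MapClusterPt y atTop fun t => φ t x) :
    Tendsto (fun t => φ t x) atTop (𝓝ˢ Γ) := by
  intro U hU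
  obtain ⟨V, hV, hVU, hVinv⟩ := hΓ U hU
  obtain ⟨t, ht⟩ := (hxy.frequently (nhds_le_nhdsSet hy hV)).exists
  refine mem_map.2 ?_
  filter_upwards [eventually_ge_atTop t] with s hs
  have := hVinv _ ht (s - t) (sub_nonneg.2 hs)
  rw [hφadd, sub_add_cancel] at this
  exact hVU this

lemma IsHyperStable.isLyapunovStable {φ : ℝ → M → M} {Γ : Set M} (hΓ : IsHyperStable φ Γ) :
    IsLyapunovStable φ Γ := by
  by_contra h
  obtain ⟨hmin, W, hW, hWΓ⟩ := hΓ
  have := hWΓ Γ hmin h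
  rw [inter_eq_left.2 (subset_of_mem_nhdsSet hW)] at this
  exact hmin.1.ne_empty this

/-- Orbits starting close to a hyper-stable set `Γ` converge to hyper-stable sets close to `Γ`. -/
lemma IsHyperStable.exists_nhdsSet_forall_tendsto [LocallyCompactSpace M] {φ : ℝ → M → M}
    (hφcont : Continuous fun p : ℝ × M => φ p.1 p.2)
    (hφadd : ∀ s t : ℝ, ∀ x : M, φ s (φ t x) = φ (s + t) x) {Γ O : Set M}
    (hΓ : IsHyperStable φ Γ) (hO : O ∈ 𝓝ˢ Γ) :
    ∃ V ∈ 𝓝ˢ Γ, ∀ x ∈ V, ∃ Γ' : Set M, IsHyperStable φ Γ' ∧ Γ' ⊆ O ∧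
      Tendsto (fun t => φ t x) atTop (𝓝ˢ Γ') := by
  obtain ⟨W, hW, hWΓ⟩ := hΓ.2
  obtain ⟨K, hK, hΓK, hKOW⟩ := exists_compact_between hΓ.1.2.1 isOpen_interior
    (subset_interior_iff_mem_nhdsSet.2 (inter_mem hO hW))
  obtain ⟨V, hV, hVK, hVinv⟩ := hΓ.isLyapunovStable K (subset_interior_iff_mem_nhdsSet.1 hΓK)
  refine ⟨V, hV, fun x hx => ?_⟩
  have hmem : ∀ᶠ t in atTop, φ t x ∈ K := by
    filter_upwards [eventually_ge_atTop 0] with t ht using hVK (hVinv x hx t ht)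
  have hsub : {y | MapClusterPt y atTop fun t => φ t x} ⊆ K :=
    fun y hy => hK.isClosed.mem_of_mapClusterPt hy hmem
  obtain ⟨y, -, hy⟩ := hK.exists_mapClusterPt_of_frequently hmem.frequently
  obtain ⟨Γ', hΓ'sub, hΓ'⟩ := exists_isCompactMinimalSet_subset ⟨y, hy⟩
    (hK.of_isClosed_subset isClosed_setOfPred_clusterPt hsub)
    (isFlowInvariant_setOf_mapClusterPt hφcont hφadd x)
  have hΓ'OW : Γ' ⊆ interior (O ∩ W) := (hΓ'sub.trans hsub).trans hKOW
  have hyper : IsHyperStable φ Γ' :=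
    ⟨hΓ', W, mem_of_superset (subset_interior_iff_mem_nhdsSet.1 hΓ'OW) inter_subset_right, hWΓ⟩
  obtain ⟨z, hz⟩ := hΓ'.1
  exact ⟨Γ', hyper, (hΓ'OW.trans interior_subset).trans inter_subset_left,
    hyper.isLyapunovStable.tendsto_nhdsSet hφadd hz (hΓ'sub hz)⟩

lemma IsCompactMinimalSet.eq_of_tendsto {φ : ℝ → M → M} {Γ Γ' : Set M}
    (hΓ : IsCompactMinimalSet φ Γ) (hΓ' : IsCompactMinimalSet φ Γ') {x : M}
    (h : Tendsto (fun t => φ t x) atTop (𝓝ˢ Γ)) (h' : Tendsto (fun t => φ t x) atTop (𝓝ˢ Γ')) :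
    Γ = Γ' := by
  refine hΓ.eq_of_inter_nonempty hΓ' (not_disjoint_iff_nonempty_inter.1 fun hd => ?_)
  have := separatedNhds_iff_disjoint.1 (SeparatedNhds.of_isCompact_isCompact hΓ.2.1 hΓ'.2.1 hd)
  exact NeBot.ne (inferInstance : (atTop : Filter ℝ).NeBot)
    (by simpa using tendsto_inf.2 ⟨h, h'⟩ |>.mono_right this.le_bot)

/-- The set of points whose orbit converges to a hyper-stable set. -/
def hyperStableBasin (φ : ℝ → M → M) : Set M :=
  {x | ∃ q : HSset φ, Tendsto (fun t => φ t x) atTop (𝓝ˢ (q.1 : Set M))}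

/-- The hyper-stable set to which a point of the basin converges. -/
noncomputable def hyperStableLimit (φ : ℝ → M → M) (x : hyperStableBasin φ) : HSset φ :=
  x.2.choose

lemma tendsto_hyperStableLimit {φ : ℝ → M → M} (x : hyperStableBasin φ) :
    Tendsto (fun t => φ t x) atTop (𝓝ˢ ((hyperStableLimit φ x).1 : Set M)) :=
  x.2.choose_spec

lemma hyperStableLimit_eq {φ : ℝ → M → M} {x : hyperStableBasin φ} {q : HSset φ}
    (h : Tendsto (fun t => φ t x) atTop (𝓝ˢ (q.1 : Set M))) : hyperStableLimit φ x = q :=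
  Subtype.ext <| SetLike.coe_injective <|
    (hyperStableLimit φ x).2.1.eq_of_tendsto q.2.1 (tendsto_hyperStableLimit x) h

lemma tendsto_nhdsSet_of_mem {φ : ℝ → M → M} (q : HSset φ) {x : M} (hx : x ∈ (q.1 : Set M)) :
    Tendsto (fun t => φ t x) atTop (𝓝ˢ (q.1 : Set M)) :=
  tendsto_principal.2 (.of_forall fun t => q.2.1.2.2.1 x hx t) |>.mono_right principal_le_nhdsSet

/-- Points close to a point converging to `q` converge to hyper-stable sets close to `q`. -/
lemma eventually_exists_tendsto [LocallyCompactSpace M] {φ : ℝ → M → M}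
    (hφcont : Continuous fun p : ℝ × M => φ p.1 p.2)
    (hφzero : ∀ x : M, φ 0 x = x)
    (hφadd : ∀ s t : ℝ, ∀ x : M, φ s (φ t x) = φ (s + t) x) {x : M} {q : HSset φ}
    (hx : Tendsto (fun t => φ t x) atTop (𝓝ˢ (q.1 : Set M))) {N : Set (HSset φ)} (hN : N ∈ 𝓝 q) :
    ∀ᶠ y in 𝓝 x, ∃ q' ∈ N, Tendsto (fun t => φ t y) atTop (𝓝ˢ (q'.1 : Set M)) := by
  obtain ⟨N', hN', hNN'⟩ := mem_nhds_subtype _ _ _ |>.1 hN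
  obtain ⟨O, hO, hqO, hON⟩ := q.2.1.exists_isOpen_forall_subset_mem hφcont hφzero hφadd hN'
  obtain ⟨V, hV, hVlim⟩ :=
    q.2.exists_nhdsSet_forall_tendsto hφcont hφadd (hO.mem_nhdsSet.2 hqO)
  obtain ⟨s, hs⟩ := (hx.eventually (isOpen_interior.mem_nhdsSet.2
    (subset_interior_iff_mem_nhdsSet.2 hV))).exists
  have hcont : ContinuousAt (φ s) x :=
    (hφcont.comp (continuous_const.prodMk continuous_id)).continuousAt
  filter_upwards [hcont (isOpen_interior.mem_nhds hs)] with y hy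
  obtain ⟨Γ', hΓ', hΓ'O, hlim⟩ := hVlim _ (interior_subset hy)
  let K : NonemptyCompacts M := ⟨⟨Γ', hΓ'.1.2.1⟩, hΓ'.1.1⟩
  refine ⟨⟨K, hΓ'⟩, hNN' (hON K hΓ'.1 hΓ'O), ?_⟩
  have := hlim.comp (tendsto_atTop_add_const_right atTop (-s) tendsto_id)
  refine this.congr fun t => ?_
  simp [hφadd]

lemma isOpen_hyperStableBasin [LocallyCompactSpace M] {φ : ℝ → M → M}
    (hφcont : Continuous fun p : ℝ × M => φ p.1 p.2)
    (hφzero : ∀ x : M, φ 0 x = x)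
    (hφadd : ∀ s t : ℝ, ∀ x : M, φ s (φ t x) = φ (s + t) x) : IsOpen (hyperStableBasin φ) := by
  refine isOpen_iff_mem_nhds.2 fun x ⟨q, hq⟩ => ?_
  filter_upwards [eventually_exists_tendsto hφcont hφzero hφadd hq univ_mem] with y ⟨q', _, hq'⟩
  exact ⟨q', hq'⟩

lemma continuous_hyperStableLimit [LocallyCompactSpace M] {φ : ℝ → M → M}
    (hφcont : Continuous fun p : ℝ × M => φ p.1 p.2)
    (hφzero : ∀ x : M, φ 0 x = x)
    (hφadd : ∀ s t : ℝ, ∀ x : M, φ s (φ t x) = φ (s + t) x) :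
    Continuous (hyperStableLimit φ) := by
  refine continuous_iff_continuousAt.2 fun x N hN => mem_map.2 ?_
  filter_upwards [continuous_subtype_val.continuousAt.eventually
    (eventually_exists_tendsto hφcont hφzero hφadd (tendsto_hyperStableLimit x) hN)]
    with y ⟨q', hq'N, hq'⟩
  rwa [mem_preimage, hyperStableLimit_eq hq']

/-- The image under the limit map of a neighborhood of a hyper-stable set `q` in `M` is a
neighborhood of `q`. -/
lemma mem_nhds_of_forall_hyperStableLimit {φ : ℝ → M → M} {q : HSset φ} {U : Set M}
    (hU : U ∈ 𝓝ˢ (q.1 : Set M)) {N : Set (HSset φ)}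
    (hN : ∀ x : hyperStableBasin φ, (x : M) ∈ U → hyperStableLimit φ x ∈ N) : N ∈ 𝓝 q := by
  filter_upwards [continuous_subtype_val.continuousAt.eventually
    (NonemptyCompacts.eventually_subset hU)] with q' hq'
  obtain ⟨z, hz⟩ := q'.1.nonempty
  have hlim := tendsto_nhdsSet_of_mem q' hz
  rw [← hyperStableLimit_eq (x := ⟨z, q', hlim⟩) hlim]
  exact hN _ (hq' hz)

lemma image_hyperStableBasin_mem_nhdsSet [LocallyCompactSpace M] {φ : ℝ → M → M}
    (hφcont : Continuous fun p : ℝ × M => φ p.1 p.2)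
    (hφzero : ∀ x : M, φ 0 x = x)
    (hφadd : ∀ s t : ℝ, ∀ x : M, φ s (φ t x) = φ (s + t) x)
    {q : HSset φ} {N : Set (HSset φ)} (hN : hyperStableLimit φ ⁻¹' N ∈
      𝓝ˢ (Subtype.val ⁻¹' (q.1 : Set M) : Set (hyperStableBasin φ))) :
    Subtype.val '' (hyperStableLimit φ ⁻¹' N) ∈ 𝓝ˢ (q.1 : Set M) := by
  refine mem_nhdsSet_iff_forall.2 fun x hx => ?_
  have hxB : x ∈ hyperStableBasin φ := ⟨q, tendsto_nhdsSet_of_mem q hx⟩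
  exact (isOpen_hyperStableBasin hφcont hφzero hφadd).isOpenEmbedding_subtypeVal.image_mem_nhds
    (x := ⟨x, hxB⟩) |>.2 (mem_nhdsSet_iff_forall.1 hN ⟨x, hxB⟩ hx)

lemma isCoinducing_hyperStableLimit [LocallyCompactSpace M] {φ : ℝ → M → M}
    (hφcont : Continuous fun p : ℝ × M => φ p.1 p.2)
    (hφzero : ∀ x : M, φ 0 x = x)
    (hφadd : ∀ s t : ℝ, ∀ x : M, φ s (φ t x) = φ (s + t) x) :
    IsCoinducing (hyperStableLimit φ) := by
  refine isCoinducing_iff.2 fun N =>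
    ⟨fun h => ?_, fun h => h.preimage (continuous_hyperStableLimit hφcont hφzero hφadd)⟩
  refine isOpen_iff_mem_nhds.2 fun q hq => mem_nhds_of_forall_hyperStableLimit
    (image_hyperStableBasin_mem_nhdsSet hφcont hφzero hφadd (h.mem_nhdsSet.2 fun x hx => ?_)) ?_
  · rwa [mem_preimage, hyperStableLimit_eq (tendsto_nhdsSet_of_mem q hx)]
  · rintro x ⟨y, hy, hyx⟩
    rwa [← Subtype.ext hyx]

lemma locallyCompactSpace_HSset [LocallyCompactSpace M] {φ : ℝ → M → M}
    (hφcont : Continuous fun p : ℝ × M => φ p.1 p.2)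
    (hφzero : ∀ x : M, φ 0 x = x)
    (hφadd : ∀ s t : ℝ, ∀ x : M, φ s (φ t x) = φ (s + t) x) :
    LocallyCompactSpace (HSset φ) := by
  have hcont := continuous_hyperStableLimit hφcont hφzero hφadd
  have hemb := (isOpen_hyperStableBasin hφcont hφzero hφadd).isOpenEmbedding_subtypeVal
  refine ⟨fun q N hN => ?_⟩
  have hpre : IsOpen (Subtype.val '' (hyperStableLimit φ ⁻¹' interior N)) :=
    hemb.isOpenMap _ (isOpen_interior.preimage hcont)
  obtain ⟨L, hL, hqL, hLN⟩ := exists_compact_between q.1.isCompact hpre fun x hx => by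
    have hlim := tendsto_nhdsSet_of_mem q hx
    refine ⟨⟨x, q, hlim⟩, ?_, rfl⟩
    rw [mem_preimage, hyperStableLimit_eq hlim]
    exact mem_interior_iff_mem_nhds.2 hN
  refine ⟨hyperStableLimit φ '' (Subtype.val ⁻¹' L), ?_, ?_, ?_⟩
  · exact mem_nhds_of_forall_hyperStableLimit (subset_interior_iff_mem_nhdsSet.1 hqL)
      fun x hx => mem_image_of_mem _ hx
  · rintro _ ⟨x, hx, rfl⟩
    obtain ⟨y, hy, hyx⟩ := hLN hx
    rw [← Subtype.ext hyx]
    exact interior_subset hy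
  · exact (hemb.isInducing.isCompact_preimage' hL fun x hx => by
      obtain ⟨y, -, rfl⟩ := hLN hx
      exact mem_range_self y).image hcont

theorem HS_locallyCompact_locallyConnected [LocallyCompactSpace M] [ConnectedSpace M] [LocallyConnectedSpace M]
    (φ : ℝ → M → M)
    (hφcont : Continuous fun p : ℝ × M => φ p.1 p.2)
    (hφzero : ∀ x : M, φ 0 x = x)
    (hφadd : ∀ s t : ℝ, ∀ x : M, φ s (φ t x) = φ (s + t) x)
    :
    LocallyCompactSpace ↥(HSset φ) ∧ LocallyConnectedSpace ↥(HSset φ) := by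
  have : LocallyConnectedSpace (hyperStableBasin φ) :=
    (isOpen_hyperStableBasin hφcont hφzero hφadd).locallyConnectedSpace
  exact ⟨locallyCompactSpace_HSset hφcont hφzero hφadd,
    (isCoinducing_hyperStableLimit hφcont hφzero hφadd).locallyConnectedSpace⟩
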